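/- Let (X, Σ) be a measurable space, n ∈ ℕ, a₁,…,aₙ ∈ [0,1] with Σ_{k=1}^n a_k = 1, and let μ₁,…,μₙ be probability measures on (X,Σ). Then for every family Q ⊆ Σ, H(Σ_{k=1}^n a_k μ_k; Q) ≤ Σ_{k=1}^n a_k H(μ_k;Q) + Σ_{k=1}^n sh(a_k). -/

import Mathlib

open MeasureTheory ENNReal

/-- The Shannon function `sh(x) = -x·log₂ x` (with `sh 0 = 0`). -/
noncomputable def sh (x : ℝ) : ℝ := -(x * Real.logb 2 x)

/-- `P` is a `μ`-partition of `X`: a countable family of pairwise disjoint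
measurable sets covering `X` up to a `μ`-null set. -/
def IsMuPartition {X : Type*} [MeasurableSpace X] (μ : Measure X) (P : Set (Set X)) : Prop :=
  P.Countable ∧ (∀ s ∈ P, MeasurableSet s) ∧ P.Pairwise Disjoint ∧ μ (⋃₀ P)ᶜ = 0

/-- The `μ`-entropy `h(μ;P) = Σ_{P∈P} sh(μ(P))` of a family of sets. -/
noncomputable def partEntropy {X : Type*} [MeasurableSpace X] (μ : Measure X)
    (P : Set (Set X)) : ℝ≥0∞ :=
  ∑' s : P, ENNReal.ofReal (sh (μ s).toReal)

/-- `P ≺ Q` : every element of `P` is contained in some element of `Q`. -/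
def Finer {X : Type*} (P Q : Set (Set X)) : Prop := ∀ p ∈ P, ∃ q ∈ Q, p ⊆ q

/-- The (classical) `μ`-entropy of a family `Q`:
`H(μ;Q) = inf { h(μ;P) : P a μ-partition, P ≺ Q }`, with `inf ∅ = ∞`. -/
noncomputable def entropyH {X : Type*} [MeasurableSpace X] (μ : Measure X)
    (Q : Set (Set X)) : ℝ≥0∞ :=
  ⨅ (P : Set (Set X)) (_ : IsMuPartition μ P) (_ : Finer P Q), partEntropy μ P

/-- `m ∈ V(μ;Q)` : a weighting of `Q`, i.e. `m : Q → Measure X` with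
`m_Q(X \ Q) = 0` for all `Q ∈ Q` and `Σ_{Q∈Q} m_Q = μ`. -/
def IsWeighting {X : Type*} [MeasurableSpace X] (μ : Measure X) (Q : Set (Set X))
    (m : Q → Measure X) : Prop :=
  (∀ q : Q, m q ((q : Set X))ᶜ = 0) ∧ Measure.sum m = μ

/-- The weighted `μ`-entropy of `m ∈ V(μ;Q)` : `hv(μ;m) = Σ_{Q∈Q} sh(m_Q(X))`. -/
noncomputable def wEntropy {X : Type*} [MeasurableSpace X] (Q : Set (Set X))
    (m : Q → Measure X) : ℝ≥0∞ :=
  ∑' q : Q, ENNReal.ofReal (sh ((m q) Set.univ).toReal)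

/-- The weighted `μ`-entropy of `Q` : `Hv(μ;Q) = inf { hv(μ;m) : m ∈ V(μ;Q) }`,
with `inf ∅ = ∞`. -/
noncomputable def entropyHv {X : Type*} [MeasurableSpace X] (μ : Measure X)
    (Q : Set (Set X)) : ℝ≥0∞ :=
  ⨅ (m : Q → Measure X) (_ : IsWeighting μ Q m), wEntropy Q m

/-- The family of all closed balls of radius `δ`. -/
def ballFam (X : Type*) [PseudoMetricSpace X] (δ : ℝ) : Set (Set X) :=
  Set.range (fun x : X => Metric.closedBall x δ)

/-- The lower entropy dimension `liminf_{δ→0⁺} H(μ;B_δ)/(-log₂ δ)`. -/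
noncomputable def ldimE {X : Type*} [PseudoMetricSpace X] [MeasurableSpace X]
    (μ : Measure X) : ℝ≥0∞ :=
  Filter.liminf (fun δ : ℝ => entropyH μ (ballFam X δ) / ENNReal.ofReal (-Real.logb 2 δ))
    (nhdsWithin 0 (Set.Ioi 0))

/-- The upper entropy dimension `limsup_{δ→0⁺} H(μ;B_δ)/(-log₂ δ)`. -/
noncomputable def udimE {X : Type*} [PseudoMetricSpace X] [MeasurableSpace X]
    (μ : Measure X) : ℝ≥0∞ :=
  Filter.limsup (fun δ : ℝ => entropyH μ (ballFam X δ) / ENNReal.ofReal (-Real.logb 2 δ))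
    (nhdsWithin 0 (Set.Ioi 0))

/-- `N_δ(S)` : the smallest number of closed balls of radius `δ` needed to cover `S`. -/
noncomputable def coverNum {X : Type*} [PseudoMetricSpace X] (S : Set X) (δ : ℝ) : ℝ≥0∞ :=
  ⨅ (t : Finset X) (_ : S ⊆ ⋃ x ∈ t, Metric.closedBall x δ), (t.card : ℝ≥0∞)

/-- The natural logarithm on `ℝ≥0∞` (with `log ∞ = ∞`), truncated to `ℝ≥0∞`. -/
noncomputable def logENN (x : ℝ≥0∞) : ℝ≥0∞ :=
  if x = ⊤ then ⊤ else ENNReal.ofReal (Real.log x.toReal)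

/-- The upper box dimension `limsup_{δ→0⁺} log N_δ(S)/(-log δ)`. -/
noncomputable def ubdimB {X : Type*} [PseudoMetricSpace X] (S : Set X) : ℝ≥0∞ :=
  Filter.limsup (fun δ : ℝ => logENN (coverNum S δ) / ENNReal.ofReal (-Real.log δ))
    (nhdsWithin 0 (Set.Ioi 0))

/-- The upper local dimension `D̄_μ(x) = limsup_{δ→0⁺} log μ(B(x,δ))/log δ`
(interpreted as `∞` when `μ(B(x,δ)) = 0`). -/
noncomputable def upLocalDim {X : Type*} [PseudoMetricSpace X] [MeasurableSpace X]
    (μ : Measure X) (x : X) : ℝ≥0∞ :=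
  Filter.limsup
    (fun δ : ℝ => if μ (Metric.closedBall x δ) = 0 then ⊤ else
      ENNReal.ofReal (Real.log (μ (Metric.closedBall x δ)).toReal / Real.log δ))
    (nhdsWithin 0 (Set.Ioi 0))

/-- A countable family of measurable sets with summable weights can be disjointified so that every
point is assigned to a set of maximal weight among those containing it. -/
lemma exists_disjoint_refinement_maximizing {X ι : Type*} [MeasurableSpace X] [Countable ι]
    (A : ι → Set X) (hA : ∀ i, MeasurableSet (A i)) (w : ι → ℝ≥0∞) (hw : ∑' i, w i ≠ ∞) :
    ∃ B : ι → Set X, (∀ i, MeasurableSet (B i)) ∧ Pairwise (Function.onFun Disjoint B) ∧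
      (∀ i, B i ⊆ A i) ∧ (⋃ i, A i) ⊆ ⋃ i, B i ∧
      ∀ i j, ∀ x ∈ B i, x ∈ A j → w j ≤ w i := by
  obtain ⟨f, hf⟩ := exists_injective_nat ι
  let key : ι → ℝ≥0∞ ×ₗ ℕᵒᵈ := fun i => toLex (w i, OrderDual.toDual (f i))
  have key_inj : Function.Injective key := fun i j h => hf
    (congrArg (fun z => OrderDual.ofDual (ofLex z).2) h)
  have w_le : ∀ i j, key i ≤ key j → w i ≤ w j := fun i j h => by
    rcases (Prod.Lex.le_iff).1 h with h | h
    · exact h.le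
    · exact h.1.le
  refine ⟨fun i => A i \ ⋃ j ∈ {j | key i < key j}, A j, fun i => ?_, fun i j hij => ?_,
    fun i => Set.sdiff_subset, fun x hx => ?_, fun i j x hx hxj => ?_⟩
  · exact (hA i).diff (MeasurableSet.biUnion (Set.to_countable _) fun j _ => hA j)
  · refine Set.disjoint_left.2 fun x hxi hxj => ?_
    simp only [Set.mem_sdiff, Set.mem_iUnion, Set.mem_ofPred_eq, not_exists] at hxi hxj
    rcases lt_or_gt_of_ne (key_inj.ne hij) with h | h
    · exact hxi.2 j h hxj.1
    · exact hxj.2 i h hxi.1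
  · suffices ∃ i, x ∈ A i ∧ ∀ j, x ∈ A j → key j ≤ key i by
      obtain ⟨i, hi, hmax⟩ := this
      refine Set.mem_iUnion.2 ⟨i, hi, ?_⟩
      simp only [Set.mem_iUnion, Set.mem_ofPred_eq, not_exists]
      exact fun j hj hxj => (hmax j hxj).not_gt hj
    by_cases hpos : ∃ i, x ∈ A i ∧ w i ≠ 0
    · obtain ⟨i₀, hi₀, hw₀⟩ := hpos
      have hfin : {i | w i₀ ≤ w i}.Finite := ENNReal.finite_const_le_of_tsum_ne_top hw hw₀
      obtain ⟨i, ⟨-, hi⟩, hmax⟩ := Set.exists_max_image ({i | w i₀ ≤ w i} ∩ {i | x ∈ A i}) key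
        (hfin.inter_of_left _) ⟨i₀, le_refl (w i₀), hi₀⟩
      refine ⟨i, hi, fun j hj => ?_⟩
      rcases le_total (key i₀) (key j) with h | h
      · exact hmax j ⟨w_le _ _ h, hj⟩
      · exact h.trans (hmax i₀ ⟨le_refl (w i₀), hi₀⟩)
    · push Not at hpos
      obtain ⟨i, hi, hmin⟩ := (InvImage.wf f Nat.lt_wfRel.wf).has_min {i | x ∈ A i}
        (Set.mem_iUnion.1 hx)
      refine ⟨i, hi, fun j hj => (Prod.Lex.le_iff).2 (Or.inr ⟨?_, ?_⟩)⟩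
      · exact (hpos j hj).trans (hpos i hi).symm
      · exact OrderDual.toDual_le_toDual.2 (not_lt.1 (hmin j hj))
  · simp only [Set.mem_sdiff, Set.mem_iUnion, Set.mem_ofPred_eq, not_exists] at hx
    exact w_le _ _ (not_lt.1 fun h => hx.2 j h hxj)

/-- The code length `-log₂ x`, with value `∞` at `0`. -/
noncomputable def codeLength (x : ℝ≥0∞) : ℝ≥0∞ :=
  if x = 0 then ∞ else ENNReal.ofReal (-Real.logb 2 x.toReal)

lemma codeLength_le_of_le {x y : ℝ≥0∞} (hxy : x ≤ y) (hy : y ≠ ∞) :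
    codeLength y ≤ codeLength x := by
  unfold codeLength
  by_cases hx : x = 0
  · simp [hx]
  · have hy0 : y ≠ 0 := fun h => hx (le_zero_iff.1 (h ▸ hxy))
    rw [if_neg hx, if_neg hy0]
    refine ENNReal.ofReal_le_ofReal (neg_le_neg ?_)
    exact Real.logb_le_logb_of_le (by norm_num)
      (ENNReal.toReal_pos hx (ne_top_of_le_ne_top hy hxy)) (ENNReal.toReal_mono hy hxy)

lemma sh_nonneg {x : ℝ} (h0 : 0 ≤ x) (h1 : x ≤ 1) : 0 ≤ sh x := by
  unfold sh
  have := Real.logb_nonpos (b := 2) (by norm_num) h0 h1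
  nlinarith

lemma sh_mul (x y : ℝ) : sh (x * y) = x * sh y + y * sh x := by
  unfold sh
  rcases eq_or_ne x 0 with rfl | hx
  · simp
  rcases eq_or_ne y 0 with rfl | hy
  · simp
  rw [Real.logb_mul hx hy]
  ring

lemma mul_codeLength {x : ℝ≥0∞} (hx : x ≠ ∞) :
    x * codeLength x = ENNReal.ofReal (sh x.toReal) := by
  unfold codeLength
  split_ifs with h
  · simp [h, sh]
  · rw [sh, ← mul_neg, ENNReal.ofReal_mul ENNReal.toReal_nonneg, ENNReal.ofReal_toReal hx]

/-- Pointwise form of Gibbs' inequality. -/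
lemma ofReal_sh_add_le {p m : ℝ≥0∞} (hp : p ≤ 1) (hm : m ≤ 1) :
    ENNReal.ofReal (sh p.toReal) + p * ENNReal.ofReal (Real.log 2)⁻¹ ≤
      p * codeLength m + m * ENNReal.ofReal (Real.log 2)⁻¹ := by
  have hpt : p ≠ ∞ := ne_top_of_le_ne_top ENNReal.one_ne_top hp
  have hmt : m ≠ ∞ := ne_top_of_le_ne_top ENNReal.one_ne_top hm
  rcases eq_or_ne p 0 with rfl | hp0
  · simp [sh]
  rcases eq_or_ne m 0 with rfl | hm0
  · simp [codeLength, hp0]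
  have hL : 0 < Real.log 2 := Real.log_pos (by norm_num)
  rw [codeLength, if_neg hm0]
  lift p to NNReal using hpt
  lift m to NNReal using hmt
  have hp1 : (p : ℝ) ≤ 1 := by exact_mod_cast hp
  have hm1 : (m : ℝ) ≤ 1 := by exact_mod_cast hm
  have hp' : (0 : ℝ) < p := by exact_mod_cast (pos_iff_ne_zero.2 hp0)
  have hm' : (0 : ℝ) < m := by exact_mod_cast (pos_iff_ne_zero.2 hm0)
  have hlog : 0 ≤ -Real.logb 2 (m : ℝ) :=
    neg_nonneg.2 (Real.logb_nonpos (by norm_num) hm'.le hm1)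
  simp only [ENNReal.coe_toReal]
  rw [← ENNReal.ofReal_coe_nnreal (p := p), ← ENNReal.ofReal_coe_nnreal (p := m),
    ← ENNReal.ofReal_mul hp'.le, ← ENNReal.ofReal_mul hp'.le, ← ENNReal.ofReal_mul hm'.le,
    ← ENNReal.ofReal_add (sh_nonneg hp'.le hp1) (by positivity),
    ← ENNReal.ofReal_add (by positivity) (by positivity)]
  refine ENNReal.ofReal_le_ofReal ?_
  have key := Real.log_le_sub_one_of_pos (div_pos hm' hp')
  rw [Real.log_div hm'.ne' hp'.ne'] at key
  have key' : (p : ℝ) * (Real.log m - Real.log p) ≤ m - p := by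
    calc (p : ℝ) * (Real.log m - Real.log p) ≤ p * (m / p - 1) := by gcongr
      _ = m - p := by field_simp
  simp only [sh, Real.logb]
  have := mul_le_mul_of_nonneg_right key' (inv_nonneg.2 hL.le)
  simp only [div_eq_mul_inv]
  linarith

/-- Gibbs' inequality. -/
lemma tsum_ofReal_sh_le_tsum_mul_codeLength {ι : Type*} {p m : ι → ℝ≥0∞}
    (hp : ∑' i, p i = 1) (hm : ∑' i, m i = 1) :
    ∑' i, ENNReal.ofReal (sh (p i).toReal) ≤ ∑' i, p i * codeLength (m i) := by
  have h := ENNReal.tsum_le_tsum fun i =>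
    ofReal_sh_add_le (hp ▸ ENNReal.le_tsum i : p i ≤ 1) (hm ▸ ENNReal.le_tsum i : m i ≤ 1)
  rw [ENNReal.tsum_add, ENNReal.tsum_add, ENNReal.tsum_mul_right, ENNReal.tsum_mul_right, hp, hm,
    one_mul] at h
  exact (ENNReal.add_le_add_iff_right ENNReal.ofReal_ne_top).1 h

/-- The family of members of `B` has entropy at most the sum over the index set. -/
lemma partEntropy_range_le {X ι : Type*} [MeasurableSpace X] (μ : Measure X) (B : ι → Set X) :
    partEntropy μ (Set.range B) ≤ ∑' i, ENNReal.ofReal (sh (μ (B i)).toReal) := by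
  refine le_of_eq_of_le (tsum_congr fun s => ?_)
    (ENNReal.tsum_comp_le_tsum_of_injective (Set.rangeSplitting_injective B) _)
  rw [Set.apply_rangeSplitting B s]

/-- The entropy of `Q` is at most the entropy of any decomposition of `μ` into countably many
measures, each concentrated on a measurable subset of a member of `Q`. -/
lemma entropyH_sum_le {X ι : Type*} [MeasurableSpace X] [Countable ι] (ν : ι → Measure X)
    [hμ : IsProbabilityMeasure (Measure.sum ν)] (A : ι → Set X) (hA : ∀ i, MeasurableSet (A i))
    (hν : ∀ i, ν i (A i)ᶜ = 0) (Q : Set (Set X)) (hAQ : ∀ i, ∃ q ∈ Q, A i ⊆ q) :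
    entropyH (Measure.sum ν) Q ≤ ∑' i, ENNReal.ofReal (sh (ν i Set.univ).toReal) := by
  have hw : ∑' i, ν i Set.univ = 1 := by
    rw [← Measure.sum_apply _ MeasurableSet.univ, measure_univ]
  have hfin : ∀ i, ν i Set.univ ≠ ∞ := fun i =>
    ne_top_of_le_ne_top ENNReal.one_ne_top (hw ▸ ENNReal.le_tsum i)
  obtain ⟨B, hB, hdisj, hBA, hcover, hmax⟩ :=
    exists_disjoint_refinement_maximizing A hA (fun i => ν i Set.univ) (by simp [hw])
  have hnull : Measure.sum ν (⋃ i, B i)ᶜ = 0 := by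
    rw [Measure.sum_apply _ (MeasurableSet.iUnion hB).compl, ENNReal.tsum_eq_zero]
    refine fun i => measure_mono_null (Set.compl_subset_compl.2 ?_) (hν i)
    exact (Set.subset_iUnion A i).trans hcover
  have hp : ∑' i, Measure.sum ν (B i) = 1 := by
    rw [← measure_iUnion hdisj hB]
    exact (prob_compl_eq_zero_iff (MeasurableSet.iUnion hB)).1 hnull
  have hpart : IsMuPartition (Measure.sum ν) (Set.range B) := by
    refine ⟨Set.countable_range B, Set.forall_mem_range.2 hB, ?_, by rwa [Set.sUnion_range]⟩
    rintro _ ⟨i, rfl⟩ _ ⟨j, rfl⟩ hij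
    exact hdisj fun h => hij (h ▸ rfl)
  have hfiner : Finer (Set.range B) Q := by
    rintro _ ⟨i, rfl⟩
    obtain ⟨q, hq, hAq⟩ := hAQ i
    exact ⟨q, hq, (hBA i).trans hAq⟩
  have hcost : ∀ i j, ν j (B i) * codeLength (ν i Set.univ) ≤
      ν j (B i) * codeLength (ν j Set.univ) := fun i j => by
    rcases (B i ∩ A j).eq_empty_or_nonempty with h | ⟨x, hxB, hxA⟩
    · have : ν j (B i) = 0 := measure_mono_null
        (Set.disjoint_iff_inter_eq_empty.2 h).subset_compl_right (hν j)
      simp [this]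
    · gcongr
      exact codeLength_le_of_le (hmax i j x hxB hxA) (hfin i)
  calc entropyH (Measure.sum ν) Q
      ≤ partEntropy (Measure.sum ν) (Set.range B) := iInf₂_le_of_le _ hpart (iInf_le _ hfiner)
    _ ≤ ∑' i, ENNReal.ofReal (sh (Measure.sum ν (B i)).toReal) := partEntropy_range_le _ B
    _ ≤ ∑' i, Measure.sum ν (B i) * codeLength (ν i Set.univ) :=
        tsum_ofReal_sh_le_tsum_mul_codeLength hp hw
    _ = ∑' i, ∑' j, ν j (B i) * codeLength (ν i Set.univ) := by
        simp_rw [Measure.sum_apply _ (hB _), ENNReal.tsum_mul_right]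
    _ ≤ ∑' i, ∑' j, ν j (B i) * codeLength (ν j Set.univ) :=
        ENNReal.tsum_le_tsum fun i => ENNReal.tsum_le_tsum fun j => hcost i j
    _ = ∑' j, ν j (⋃ i, B i) * codeLength (ν j Set.univ) := by
        rw [ENNReal.tsum_comm]
        simp_rw [ENNReal.tsum_mul_right, measure_iUnion hdisj hB]
    _ ≤ ∑' j, ν j Set.univ * codeLength (ν j Set.univ) := by
        gcongr
        exact Set.subset_univ _
    _ = ∑' j, ENNReal.ofReal (sh (ν j Set.univ).toReal) := by
        simp_rw [mul_codeLength (hfin _)]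

/-- Entropy of a partition with respect to a probability measure rescaled by `a`. -/
lemma tsum_ofReal_sh_smul_eq {X : Type*} [MeasurableSpace X] {a : ℝ} (ha : a ∈ Set.Icc (0 : ℝ) 1)
    (μ : Measure X) [IsProbabilityMeasure μ] {P : Set (Set X)} (hP : IsMuPartition μ P) :
    ∑' s : P, ENNReal.ofReal (sh (ENNReal.ofReal a * μ s).toReal) =
      ENNReal.ofReal a * partEntropy μ P + ENNReal.ofReal (sh a) := by
  obtain ⟨hcount, hmeas, hdisj, hnull⟩ := hP
  have htotal : ∑' s : P, μ s = 1 := by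
    rw [← measure_sUnion hcount hdisj hmeas]
    exact (prob_compl_eq_zero_iff (MeasurableSet.sUnion hcount hmeas)).1 hnull
  have hterm : ∀ s : P, ENNReal.ofReal (sh (ENNReal.ofReal a * μ s).toReal) =
      ENNReal.ofReal a * ENNReal.ofReal (sh (μ s).toReal) + μ s * ENNReal.ofReal (sh a) := by
    intro s
    have h1 : (μ (s : Set X)).toReal ≤ 1 := measureReal_le_one
    have hs := sh_nonneg ENNReal.toReal_nonneg h1
    have ha' := sh_nonneg ha.1 ha.2
    rw [ENNReal.toReal_mul, ENNReal.toReal_ofReal ha.1, sh_mul,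
      ENNReal.ofReal_add (mul_nonneg ha.1 hs) (mul_nonneg ENNReal.toReal_nonneg ha'),
      ENNReal.ofReal_mul ha.1, ENNReal.ofReal_mul ENNReal.toReal_nonneg,
      ENNReal.ofReal_toReal (measure_ne_top _ _)]
  simp_rw [hterm]
  rw [ENNReal.tsum_add, ENNReal.tsum_mul_left, ENNReal.tsum_mul_right, htotal, one_mul]
  rfl

/-- Mixture bound for fixed partitions. -/
lemma entropyH_mixture_le_of_isMuPartition {X κ : Type*} [MeasurableSpace X] [Fintype κ]
    (a : κ → ℝ) (ha : ∀ k, a k ∈ Set.Icc (0 : ℝ) 1) (hsum : ∑ k, a k = 1)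
    (μ : κ → Measure X) [∀ k, IsProbabilityMeasure (μ k)] (Q : Set (Set X))
    (P : κ → Set (Set X)) (hP : ∀ k, IsMuPartition (μ k) (P k)) (hPQ : ∀ k, Finer (P k) Q) :
    entropyH (∑ k, ENNReal.ofReal (a k) • μ k) Q ≤
      ∑ k, ENNReal.ofReal (a k) * partEntropy (μ k) (P k) +
        ∑ k, ENNReal.ofReal (sh (a k)) := by
  let ν : (Σ k, P k) → Measure X := fun j => (ENNReal.ofReal (a j.1) • μ j.1).restrict j.2
  have : ∀ k, Countable (P k) := fun k => (hP k).1.to_subtype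
  have hmeas : ∀ j : Σ k, P k, MeasurableSet (j.2 : Set X) := fun j => (hP j.1).2.1 _ j.2.2
  have hrestrict : ∀ k, Measure.sum (fun s : P k => ν ⟨k, s⟩) = ENNReal.ofReal (a k) • μ k := by
    intro k
    obtain ⟨hcount, hmeas, hdisj, hnull⟩ := hP k
    rw [← Measure.restrict_iUnion (μ := ENNReal.ofReal (a k) • μ k)
      (s := fun s : P k => (s : Set X))
      (fun s t hst => hdisj s.2 t.2 (Subtype.coe_injective.ne hst)) (fun s => hmeas s s.2),
      ← Set.sUnion_eq_iUnion]
    refine Measure.restrict_eq_self_of_ae_mem ?_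
    exact Measure.ae_smul_measure (measure_eq_zero_iff_ae_notMem.1 hnull |>.mono (by simp)) _
  have hν : Measure.sum ν = ∑ k, ENNReal.ofReal (a k) • μ k := by
    ext s hs
    simp_rw [Measure.sum_apply _ hs, ENNReal.tsum_sigma', ← hrestrict, tsum_fintype,
      Measure.finsetSum_apply, Measure.sum_apply _ hs]
  have hprob : IsProbabilityMeasure (Measure.sum ν) := ⟨by
    simp [hν, Measure.finsetSum_apply, ← ENNReal.ofReal_sum_of_nonneg fun k _ => (ha k).1, hsum]⟩
  calc entropyH (∑ k, ENNReal.ofReal (a k) • μ k) Q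
      ≤ ∑' j, ENNReal.ofReal (sh (ν j Set.univ).toReal) := by
        rw [← hν]
        exact entropyH_sum_le ν (fun j => j.2) hmeas
          (fun j => by simp [ν, Measure.restrict_apply (hmeas j).compl]) Q
          fun j => hPQ j.1 _ j.2.2
    _ = ∑ k, ∑' s : P k, ENNReal.ofReal (sh (ENNReal.ofReal (a k) * μ k s).toReal) := by
        simp [ν, ENNReal.tsum_sigma', tsum_fintype]
    _ = _ := by
        simp_rw [tsum_ofReal_sh_smul_eq (ha _) _ (hP _), Finset.sum_add_distrib]

/-- A partition finer than `Q` of entropy less than a bound exceeding the entropy of `Q`. -/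
lemma exists_isMuPartition_partEntropy_lt {X : Type*} [MeasurableSpace X] {μ : Measure X}
    {Q : Set (Set X)} {c : ℝ≥0∞} (h : entropyH μ Q < c) :
    ∃ P, IsMuPartition μ P ∧ Finer P Q ∧ partEntropy μ P < c := by
  simpa only [entropyH, iInf_lt_iff, exists_prop] using h

lemma entropyH_mixture_le_of_pos {X κ : Type*} [MeasurableSpace X] [Fintype κ]
    (a : κ → ℝ) (ha : ∀ k, a k ∈ Set.Ioc (0 : ℝ) 1) (hsum : ∑ k, a k = 1)
    (μ : κ → Measure X) [∀ k, IsProbabilityMeasure (μ k)] (Q : Set (Set X)) :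
    entropyH (∑ k, ENNReal.ofReal (a k) • μ k) Q ≤
      ∑ k, ENNReal.ofReal (a k) * entropyH (μ k) Q + ∑ k, ENNReal.ofReal (sh (a k)) := by
  by_cases htop : ∃ k, entropyH (μ k) Q = ∞
  · obtain ⟨k, hk⟩ := htop
    have : ∑ k, ENNReal.ofReal (a k) * entropyH (μ k) Q = ∞ :=
      ENNReal.sum_eq_top.2 ⟨k, Finset.mem_univ k, by simp [hk, ENNReal.mul_top, (ha k).1]⟩
    simp [this]
  push Not at htop
  refine ENNReal.le_of_forall_pos_le_add fun ε hε _ => ?_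
  have hlt : ∀ k, entropyH (μ k) Q < entropyH (μ k) Q + ε := fun k =>
    ENNReal.lt_add_right (htop k) (by simpa using hε.ne')
  choose P hP hPQ hPε using fun k => exists_isMuPartition_partEntropy_lt (hlt k)
  have hone : ∑ k, ENNReal.ofReal (a k) = 1 := by
    rw [← ENNReal.ofReal_sum_of_nonneg fun k _ => (ha k).1.le, hsum, ENNReal.ofReal_one]
  calc entropyH (∑ k, ENNReal.ofReal (a k) • μ k) Q
      ≤ ∑ k, ENNReal.ofReal (a k) * partEntropy (μ k) (P k) + ∑ k, ENNReal.ofReal (sh (a k)) :=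
        entropyH_mixture_le_of_isMuPartition a (fun k => Set.Ioc_subset_Icc_self (ha k)) hsum μ Q
          P hP hPQ
    _ ≤ ∑ k, ENNReal.ofReal (a k) * (entropyH (μ k) Q + ε) + ∑ k, ENNReal.ofReal (sh (a k)) := by
        gcongr with k
        exact (hPε k).le
    _ = _ := by
        simp_rw [mul_add, Finset.sum_add_distrib, ← Finset.sum_mul, hone, one_mul]
        exact add_right_comm _ _ _

lemma sum_eq_sum_subtype_ne_zero {κ R M : Type*} [Fintype κ] [Zero R] [DecidableEq R]
    [AddCommMonoid M] (a : κ → R) (f : κ → M) (hf : ∀ k, a k = 0 → f k = 0) :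
    ∑ k, f k = ∑ k : {k // a k ≠ 0}, f k := by
  rw [← Finset.sum_subtype (Finset.univ.filter fun k => a k ≠ 0) (by simp)]
  exact (Finset.sum_filter_of_ne fun k _ => mt (hf k)).symm

/-- inequality (25) of Theorem 2 of the paper:
`H(Σ_k a_k μ_k; Q) ≤ Σ_k a_k H(μ_k;Q) + Σ_k sh(a_k)`. -/
theorem entropyH_mixture_le {X : Type*} [MeasurableSpace X]
    (n : ℕ) (a : Fin n → ℝ) (ha : ∀ k, a k ∈ Set.Icc (0 : ℝ) 1) (hsum : ∑ k, a k = 1)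
    (μ : Fin n → Measure X) (hμ : ∀ k, IsProbabilityMeasure (μ k))
    (Q : Set (Set X)) (hQ : ∀ q ∈ Q, MeasurableSet q) :
    entropyH (∑ k, ENNReal.ofReal (a k) • μ k) Q ≤
      ∑ k, ENNReal.ofReal (a k) * entropyH (μ k) Q + ∑ k, ENNReal.ofReal (sh (a k)) := by
  classical
  rw [sum_eq_sum_subtype_ne_zero a (fun k => ENNReal.ofReal (a k) • μ k)
      fun k hk => by simp [hk],
    sum_eq_sum_subtype_ne_zero a (fun k => ENNReal.ofReal (a k) * entropyH (μ k) Q)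
      fun k hk => by simp [hk],
    sum_eq_sum_subtype_ne_zero a (fun k => ENNReal.ofReal (sh (a k)))
      fun k hk => by simp [hk, sh]]
  rw [sum_eq_sum_subtype_ne_zero a a fun _ hk => hk] at hsum
  exact entropyH_mixture_le_of_pos (fun k : {k // a k ≠ 0} => a k)
    (fun k => ⟨(ha k).1.lt_of_ne' k.2, (ha k).2⟩) hsum (fun k => μ k) Q
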